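/- Fix T ≥ 1, plans π^1,…,π^T, indicator weights b_1,…,b_T ∈ {0,1}, and per-iteration immediate utilities u^t(I,a) ∈ ℝ. For each infoset I define û^t_I(a) = u^t(I,a) + Σ_{I' ∈ C(I,a)} V^t_{I'}(π^t), the subtree regret R_I = max over all plans π̂ of Σ_{t=1}^T b_t ( V^t_I(π̂) − V^t_I(π^t) ), and the laminar subtree regret R̂_I = max_{a ∈ A(I)} Σ_{t=1}^T b_t ( û^t_I(a) − û^t_I(π^t(I)) ). For a plan π̂ and an infoset I, let Reach(π̂, I) ⊆ 𝓘 be the smallest set containing I and such that whenever J ∈ Reach(π̂, I), every I' ∈ C(J, π̂(J)) is in Reach(π̂, I). Then for every infoset I, R_I ≤ max over all plans π̂ of Σ_{I' ∈ Reach(π̂, I)} R̂_{I'}. -/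

import Mathlib

/-- An abstract decision tree for a single player: a finite type of infosets, a nonempty finite
set of actions at each infoset, a children map, and a depth function decreasing along children. -/
structure DecisionTree (I α : Type*) where
  A : I → Finset α
  A_nonempty : ∀ i, (A i).Nonempty
  C : I → α → Finset I
  depth : I → ℕ
  depth_lt : ∀ i, ∀ a ∈ A i, ∀ j ∈ C i a, depth j < depth i

/-- The value function `V^u_I(π) = u(I, π(I)) + ∑_{I' ∈ C(I, π(I))} V^u_{I'}(π)`
(defined recursively; for plans `π` with `π i ∈ A i` everywhere the guard is always true). -/
noncomputable def DecisionTree.V {I α : Type*} [DecidableEq α] (D : DecisionTree I α)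
    (u : I → α → ℝ) (π : I → α) (i : I) : ℝ :=
  u i (π i) +
    (if h : π i ∈ D.A i then ∑ j ∈ (D.C i (π i)).attach, D.V u π j.1 else 0)
termination_by D.depth i
decreasing_by exact D.depth_lt i (π i) h j.1 j.2

/-- The descendant set `D(I) = {I} ∪ ⋃_{a ∈ A(I)} ⋃_{I' ∈ C(I,a)} D(I')`. -/
noncomputable def DecisionTree.desc {I α : Type*} [DecidableEq I] (D : DecisionTree I α)
    (i : I) : Finset I :=
  {i} ∪ (D.A i).attach.biUnion fun a => (D.C i a.1).attach.biUnion fun j => D.desc j.1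
termination_by D.depth i
decreasing_by exact D.depth_lt i a.1 a.2 j.1 j.2

namespace DecisionTree

variable {I α : Type*}

theorem V_eq [DecidableEq α] (D : DecisionTree I α) (u : I → α → ℝ) {π : I → α} {i : I}
    (h : π i ∈ D.A i) : D.V u π i = u i (π i) + ∑ j ∈ D.C i (π i), D.V u π j := by
  rw [V, dif_pos h, Finset.sum_attach _ fun j => D.V u π j]

theorem mem_desc_iff [DecidableEq I] (D : DecisionTree I α) {i k : I} :
    k ∈ D.desc i ↔ k = i ∨ ∃ a ∈ D.A i, ∃ j ∈ D.C i a, k ∈ D.desc j := by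
  rw [desc]
  simp

theorem self_mem_desc [DecidableEq I] (D : DecisionTree I α) (i : I) : i ∈ D.desc i :=
  D.mem_desc_iff.mpr (Or.inl rfl)

theorem depth_le_of_mem_desc [DecidableEq I] (D : DecisionTree I α) {i k : I}
    (hk : k ∈ D.desc i) : D.depth k ≤ D.depth i := by
  induction i using (measure D.depth).wf.induction with
  | h i ih =>
    rcases D.mem_desc_iff.mp hk with rfl | ⟨a, ha, j, hj, hkj⟩
    · rfl
    · exact (ih j (D.depth_lt i a ha j hj) hkj).trans (D.depth_lt i a ha j hj).le

theorem child_mem_desc [DecidableEq I] (D : DecisionTree I α) {i j k : I} {a : α}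
    (hj : j ∈ D.desc i) (ha : a ∈ D.A j) (hk : k ∈ D.C j a) : k ∈ D.desc i := by
  induction i using (measure D.depth).wf.induction with
  | h i ih =>
    rcases D.mem_desc_iff.mp hj with rfl | ⟨c, hc, l, hl, hjl⟩
    · exact D.mem_desc_iff.mpr (Or.inr ⟨a, ha, k, hk, D.self_mem_desc k⟩)
    · exact D.mem_desc_iff.mpr (Or.inr ⟨c, hc, l, hl, ih l (D.depth_lt i c hc l hl) hjl⟩)

/-- The sum of a function over the infosets reached from `i` splits into the value at `i` and
the sums over the infosets reached from the chosen children of `i`. -/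
theorem sum_reach_eq [DecidableEq I] (D : DecisionTree I α)
    (hdisj : ∀ i, ∀ a ∈ D.A i, ∀ j ∈ D.C i a, ∀ k ∈ D.C i a, j ≠ k →
      Disjoint (D.desc j) (D.desc k))
    {π : I → α} (hπ : ∀ i, π i ∈ D.A i) (reach : I → Finset I)
    (hself : ∀ i, i ∈ reach i)
    (hclosed : ∀ i, ∀ j ∈ reach i, ∀ k ∈ D.C j (π j), k ∈ reach i)
    (hmin : ∀ i (Q : Finset I), i ∈ Q → (∀ j ∈ Q, ∀ k ∈ D.C j (π j), k ∈ Q) → reach i ⊆ Q)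
    (f : I → ℝ) (i : I) :
    ∑ j ∈ reach i, f j = f i + ∑ k ∈ D.C i (π i), ∑ j ∈ reach k, f j := by
  have hdesc : ∀ k, reach k ⊆ D.desc k := fun k =>
    hmin k _ (D.self_mem_desc k) fun j hj l hl => D.child_mem_desc hj (hπ j) hl
  have heq : reach i = insert i ((D.C i (π i)).biUnion reach) := by
    apply Finset.Subset.antisymm
    · refine hmin i _ (Finset.mem_insert_self _ _) fun j hj k hk => ?_
      refine Finset.mem_insert_of_mem (Finset.mem_biUnion.mpr ?_)
      rcases Finset.mem_insert.mp hj with rfl | hj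
      · exact ⟨k, hk, hself k⟩
      · obtain ⟨l, hl, hjl⟩ := Finset.mem_biUnion.mp hj
        exact ⟨l, hl, hclosed l j hjl k hk⟩
    · refine Finset.insert_subset (hself i) (Finset.biUnion_subset.mpr fun k hk => ?_)
      exact hmin k _ (hclosed i i (hself i) k hk) (hclosed i)
  have hnot : i ∉ (D.C i (π i)).biUnion reach := by
    intro h
    obtain ⟨k, hk, hik⟩ := Finset.mem_biUnion.mp h
    exact (D.depth_lt i _ (hπ i) k hk).not_ge (D.depth_le_of_mem_desc (hdesc k hik))
  rw [heq, Finset.sum_insert hnot, Finset.sum_biUnion]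
  intro j hj k hk hjk
  exact (hdisj i _ (hπ i) j hj k hk hjk).mono (hdesc j) (hdesc k)

end DecisionTree

/-!
Lemma (laminar decomposition bound): the subtree regret
`R_I = max_{π̂} ∑_t b_t (V^t_I(π̂) − V^t_I(π^t))` is bounded by
`max_{π̂} ∑_{I' ∈ Reach(π̂, I)} R̂_{I'}`, where
`R̂_I = max_{a ∈ A(I)} ∑_t b_t (û^t_I(a) − û^t_I(π^t(I)))` is the laminar subtree regret and
`Reach(π̂, I)` is the smallest set of infosets containing `I` and closed under taking the
children `C(J, π̂(J))` of any of its members `J`.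
-/
theorem subtree_regret_le_laminar {I α : Type*} [Fintype I] [DecidableEq I] [DecidableEq α]
    (D : DecisionTree I α)
    -- descendant sets of distinct children (under the same action) are pairwise disjoint
    (hdisj : ∀ i, ∀ a ∈ D.A i, ∀ j ∈ D.C i a, ∀ k ∈ D.C i a, j ≠ k →
      Disjoint (D.desc j) (D.desc k))
    (T : ℕ) (hT : 1 ≤ T)
    (π : Fin T → I → α) (hπ : ∀ t, π t ∈ Fintype.piFinset D.A)
    (b : Fin T → ℝ) (hb : ∀ t, b t = 0 ∨ b t = 1)
    (u : Fin T → I → α → ℝ)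
    -- the subtree regrets
    (R : I → ℝ)
    (hR : ∀ i, R i = (Fintype.piFinset D.A).sup'
      (Fintype.piFinset_nonempty.mpr D.A_nonempty)
      fun πhat => ∑ t : Fin T, b t * (D.V (u t) πhat i - D.V (u t) (π t) i))
    -- the laminar subtree regrets
    (Rhat : I → ℝ)
    (hRhat : ∀ i, Rhat i = (D.A i).sup' (D.A_nonempty i) fun a =>
      ∑ t : Fin T, b t *
        ((u t i a + ∑ j ∈ D.C i a, D.V (u t) (π t) j) -
          (u t i (π t i) + ∑ j ∈ D.C i (π t i), D.V (u t) (π t) j)))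
    -- `Reach πhat i` is the smallest set containing `i` and closed under `C(·, πhat ·)`
    (Reach : (I → α) → I → Finset I)
    (hReach_self : ∀ πhat i, i ∈ Reach πhat i)
    (hReach_closed : ∀ πhat i, ∀ j ∈ Reach πhat i, ∀ k ∈ D.C j (πhat j), k ∈ Reach πhat i)
    (hReach_min : ∀ πhat i (Q : Finset I), i ∈ Q →
      (∀ j ∈ Q, ∀ k ∈ D.C j (πhat j), k ∈ Q) → Reach πhat i ⊆ Q) :
    ∀ i, R i ≤ (Fintype.piFinset D.A).sup'
      (Fintype.piFinset_nonempty.mpr D.A_nonempty)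
      fun πhat => ∑ j ∈ Reach πhat i, Rhat j := by
  intro i
  rw [hR]
  refine Finset.sup'_le _ _ fun πhat hπhat => ?_
  refine le_trans ?_ (Finset.le_sup' (fun πhat => ∑ j ∈ Reach πhat i, Rhat j) hπhat)
  have hmem : ∀ j, πhat j ∈ D.A j := Fintype.mem_piFinset.mp hπhat
  induction i using (measure D.depth).wf.induction with
  | h i ih =>
    rw [D.sum_reach_eq hdisj hmem (Reach πhat) (hReach_self πhat) (hReach_closed πhat)
      (hReach_min πhat)]
    have hchildren := Finset.sum_le_sum fun k hk => ih k (D.depth_lt i _ (hmem i) k hk)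
    have hroot := Finset.le_sup' (fun a => ∑ t : Fin T, b t *
        ((u t i a + ∑ j ∈ D.C i a, D.V (u t) (π t) j) -
          (u t i (π t i) + ∑ j ∈ D.C i (π t i), D.V (u t) (π t) j))) (hmem i)
    rw [← hRhat i] at hroot
    refine le_trans (le_of_eq ?_) (add_le_add hroot hchildren)
    rw [Finset.sum_comm, ← Finset.sum_add_distrib]
    refine Finset.sum_congr rfl fun t _ => ?_
    rw [D.V_eq (u t) (hmem i), D.V_eq (u t) (Fintype.mem_piFinset.mp (hπ t) i),
      ← Finset.mul_sum, Finset.sum_sub_distrib]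
    ring
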